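/- Let β > 0, σ > 0 and γ > 0. For all x, y ∈ ℝ, if cos(x) ≥ cos(y) then v^γ(x) ≤ v^γ(y). In particular, v^γ(x) ≤ v^γ(x + π) for every x ∈ [−π/2, π/2], and v^γ(0) < v^γ(π). -/

import Mathlib

open Real MeasureTheory Filter Topology

/-- At a local minimum the second derivative is nonnegative. -/
theorem IsLocalMin.deriv_deriv_nonneg {f : ℝ → ℝ} {x : ℝ} (h : IsLocalMin f x)
    (hc : ContinuousAt f x) : 0 ≤ deriv (deriv f) x := by
  by_contra! hneg
  have hmax : IsLocalMax f x := isLocalMax_of_deriv_deriv_neg hneg h.deriv_eq_zero hc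
  have heq : f =ᶠ[𝓝 x] fun _ => f x := by
    filter_upwards [h, hmax] with y h1 h2 using le_antisymm h2 h1
  have hzero : deriv (deriv f) x = 0 := by
    rw [heq.deriv.deriv_eq]
    simp
  exact hneg.ne hzero

/-- At a local maximum the second derivative is nonpositive. -/
theorem IsLocalMax.deriv_deriv_nonpos {f : ℝ → ℝ} {x : ℝ} (h : IsLocalMax f x)
    (hc : ContinuousAt f x) : deriv (deriv f) x ≤ 0 := by
  have := h.neg.deriv_deriv_nonneg hc.neg
  have hd : deriv (fun y => -f y) = fun y => -deriv f y := funext fun y => deriv.fun_neg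
  rw [hd, deriv.fun_neg] at this
  linarith

/-- A continuous periodic real function attains its maximum. -/
theorem Function.Periodic.exists_forall_le {f : ℝ → ℝ} {c : ℝ} (hf : Function.Periodic f c)
    (hc : 0 < c) (hcont : Continuous f) : ∃ x, ∀ y, f y ≤ f x := by
  obtain ⟨x, -, hx⟩ := isCompact_Icc.exists_isMaxOn (Set.nonempty_Icc.2 hc.le)
    (hcont.continuousOn (s := Set.Icc 0 c))
  refine ⟨x, fun y => ?_⟩
  obtain ⟨z, hz, hyz⟩ := hf.exists_mem_Ico₀ hc y
  rw [hyz]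
  exact hx (Set.Ico_subset_Icc_self hz)

section StationaryEquation

variable {β s γ : ℝ} {u : ℝ → ℝ}

/-- A periodic solution of the stationary equation is even. -/
theorem even_of_stationary_equation (hβ : 0 < β) (hs : 0 < s)
    (hper : Function.Periodic u (2 * π)) (hu : ContDiff ℝ 2 u)
    (hode : ∀ x, β * u x - s * deriv (deriv u) x + 1 / 2 * (deriv u x) ^ 2 = -γ * cos x) :
    ∀ x, u (-x) = u x := by
  have hd : Differentiable ℝ u := hu.differentiable (by norm_num)
  have hd' : Differentiable ℝ (deriv u) :=
    ((contDiff_succ_iff_deriv (n := 1)).1 hu).2.2.differentiable (by norm_num)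
  have hD : deriv (fun y => u y - u (-y)) = fun y => deriv u y + deriv u (-y) := by
    funext y
    rw [deriv_fun_sub (hd y) (by fun_prop), deriv_comp_neg]
    ring
  have hDD (x : ℝ) : deriv (deriv (fun y => u y - u (-y))) x
      = deriv (deriv u) x - deriv (deriv u) (-x) := by
    rw [hD, deriv_fun_add (hd' x) (by fun_prop), deriv_comp_neg]
    ring
  have hcont : Continuous fun y => u y - u (-y) := by fun_prop
  have hp : Function.Periodic (fun y => u y - u (-y)) (2 * π) := fun y => by
    simp only [hper y, neg_add, ← sub_eq_add_neg, hper.sub_eq]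
  obtain ⟨x, hx⟩ := hp.exists_forall_le two_pi_pos hcont
  have hmax : IsLocalMax (fun y => u y - u (-y)) x := Eventually.of_forall hx
  have h1 := hmax.deriv_eq_zero
  have h2 := hmax.deriv_deriv_nonpos hcont.continuousAt
  rw [hDD] at h2
  rw [hD] at h1
  have e1 := hode x
  have e2 := hode (-x)
  rw [cos_neg] at e2
  have h3 : deriv u (-x) = -deriv u x := by linarith
  rw [h3] at e2
  have hle : u x - u (-x) ≤ 0 := by
    have : β * (u x - u (-x)) ≤ 0 := by
      nlinarith [mul_nonneg hs.le (sub_nonneg.2 h2)]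
    exact nonpos_of_mul_nonpos_right this hβ
  intro y
  have a := hx y
  have b := hx (-y)
  simp only [neg_neg] at a b
  linarith

/-- The derivative of an even periodic solution is positive on `(0, π)`. -/
theorem deriv_pos_of_stationary_equation (hβ : 0 < β) (hs : 0 < s) (hγ : 0 < γ)
    (hper : Function.Periodic u (2 * π)) (hu : ContDiff ℝ 2 u)
    (hode : ∀ x, β * u x - s * deriv (deriv u) x + 1 / 2 * (deriv u x) ^ 2 = -γ * cos x)
    (heven : ∀ x, u (-x) = u x) :
    ∀ x ∈ Set.Ioo 0 π, 0 < deriv u x := by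
  have hd : Differentiable ℝ u := hu.differentiable (by norm_num)
  have hd' : Differentiable ℝ (deriv u) :=
    ((contDiff_succ_iff_deriv (n := 1)).1 hu).2.2.differentiable (by norm_num)
  have hodd (x : ℝ) : deriv u (-x) = -deriv u x := by
    have h := deriv_comp_neg u x
    rw [funext heven] at h
    linarith
  have h0 : deriv u 0 = 0 := by
    have := hodd 0
    rw [neg_zero] at this
    linarith
  have hπ : deriv u π = 0 := by
    have h := deriv_comp_add_const u (2 * π) (-π)
    rw [funext hper, show -π + 2 * π = π by ring, hodd] at h
    linarith
  have hinterior (x : ℝ) (hx : x ∈ Set.Ioo 0 π) (hmin : IsMinOn (deriv u) (Set.Icc 0 π) x) :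
      0 < deriv u x := by
    have hloc : IsLocalMin (deriv u) x := hmin.isLocalMin (Icc_mem_nhds hx.1 hx.2)
    have h1 := hloc.deriv_eq_zero
    have h2 := hloc.deriv_deriv_nonneg hd'.continuous.continuousAt
    have hdd : deriv (deriv u)
        = fun y => (β * u y + 1 / 2 * (deriv u y) ^ 2 + γ * cos y) / s := by
      funext y
      rw [eq_div_iff hs.ne']
      linarith [hode y]
    have h3 : HasDerivAt (deriv (deriv u))
        ((β * deriv u x + 1 / 2 * (2 * deriv u x * deriv (deriv u) x) + γ * -sin x) / s) x := by
      refine HasDerivAt.congr_of_eventuallyEq ?_ hdd.eventuallyEq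
      refine (((((hd x).hasDerivAt.const_mul β).fun_add
        (((hd' x).hasDerivAt.fun_pow 2).const_mul (1 / 2))).fun_add
        ((hasDerivAt_cos x).const_mul γ)).div_const s).congr_deriv ?_
      simp
    rw [h3.deriv, h1, le_div_iff₀ hs] at h2
    have hsin := mul_pos hγ (sin_pos_of_pos_of_lt_pi hx.1 hx.2)
    have : 0 < β * deriv u x := by linarith
    exact pos_of_mul_pos_right this hβ.le
  obtain ⟨m, hm, hmin⟩ := isCompact_Icc.exists_isMinOn (Set.nonempty_Icc.2 pi_pos.le)
    (hd'.continuous.continuousOn (s := Set.Icc 0 π))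
  intro x hx
  have hmx : deriv u m ≤ deriv u x := hmin (Set.Ioo_subset_Icc_self hx)
  by_cases hmi : m ∈ Set.Ioo 0 π
  · exact (hinterior m hmi hmin).trans_le hmx
  have hm0 : deriv u m = 0 := by
    rcases hm.1.eq_or_lt with h | h
    · rw [← h, h0]
    · rcases hm.2.eq_or_lt with h' | h'
      · rw [h', hπ]
      · exact absurd ⟨h, h'⟩ hmi
  by_contra! hneg
  refine hneg.not_gt (hinterior x hx fun y hy => ?_)
  exact hneg.trans (hm0 ▸ hmin hy)

end StationaryEquation

/-- An even `2π`-periodic function factors through the cosine. -/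
theorem Function.Periodic.eq_of_cos_eq {u : ℝ → ℝ} (hper : Function.Periodic u (2 * π))
    (heven : ∀ x, u (-x) = u x) {x y : ℝ} (h : cos x = cos y) : u x = u y := by
  obtain ⟨k, hk | hk⟩ := Real.cos_eq_cos_iff.1 h
  · rw [hk, show 2 * k * π + x = x + k * (2 * π) by ring, hper.int_mul k x]
  · rw [hk, show 2 * k * π - x = -x + k * (2 * π) by ring, hper.int_mul k (-x), heven]

/-- For `γ > 0`: if `cos x ≥ cos y` then `v^γ(x) ≤ v^γ(y)`;
in particular `v^γ(x) ≤ v^γ(x + π)` on `[−π/2, π/2]` and `v^γ(0) < v^γ(π)`. -/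
theorem kuramoto_value_monotone_in_cos
    (β σ : ℝ) (hβ : 0 < β) (hσ : 0 < σ)
    (v : ℝ → ℝ → ℝ)
    (hper : ∀ γ, 0 ≤ γ → Function.Periodic (v γ) (2 * π))
    (hC2 : ∀ γ, 0 ≤ γ → ContDiff ℝ 2 (v γ))
    (hODE : ∀ γ, 0 ≤ γ → ∀ x : ℝ,
      β * v γ x - σ ^ 2 / 2 * deriv (deriv (v γ)) x + (1 / 2) * (deriv (v γ) x) ^ 2
        = -γ * Real.cos x)
    (γ : ℝ) (hγ : 0 < γ) :
    (∀ x y : ℝ, Real.cos y ≤ Real.cos x → v γ x ≤ v γ y) ∧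
    (∀ x ∈ Set.Icc (-(π / 2)) (π / 2), v γ x ≤ v γ (x + π)) ∧
    v γ 0 < v γ π := by
  have hs : 0 < σ ^ 2 / 2 := by positivity
  have hp := hper γ hγ.le
  have hu := hC2 γ hγ.le
  have hode := hODE γ hγ.le
  have heven := even_of_stationary_equation hβ hs hp hu hode
  have hmono : StrictMonoOn (v γ) (Set.Icc 0 π) := by
    refine strictMonoOn_of_deriv_pos (convex_Icc 0 π) hu.continuous.continuousOn ?_
    rw [interior_Icc]
    exact deriv_pos_of_stationary_equation hβ hs hγ hp hu hode heven
  have hcos (x : ℝ) : v γ x = v γ (arccos (cos x)) :=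
    hp.eq_of_cos_eq heven (cos_arccos (neg_one_le_cos x) (cos_le_one x)).symm
  have hmain (x y : ℝ) (hxy : cos y ≤ cos x) : v γ x ≤ v γ y := by
    rw [hcos x, hcos y]
    exact hmono.monotoneOn ⟨arccos_nonneg _, arccos_le_pi _⟩ ⟨arccos_nonneg _, arccos_le_pi _⟩
      (antitone_arccos hxy)
  refine ⟨hmain, fun x hx => hmain _ _ ?_,
    hmono (Set.left_mem_Icc.2 pi_pos.le) (Set.right_mem_Icc.2 pi_pos.le) pi_pos⟩
  rw [cos_add_pi]
  linarith [cos_nonneg_of_mem_Icc hx]
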